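/- For every n ≥ 0 there is an infinite semidistributive lattice Lₙ whose congruence lattice Con Lₙ is isomorphic to Bₙ⁺, the Boolean lattice with n atoms with a new greatest element adjoined (assuming the existence of an FN lattice, i.e., a simple, infinite, semidistributive lattice, containing antichains of every finite size). Moreover, for n ≥ 1 the lattice Lₙ can be taken to have no least and no greatest element. -/

import Mathlib

/-! ### Basic definitions: semidistributivity, lattice congruences -/

/-- Join-semidistributivity: `u = x ⊔ y = x ⊔ z` implies `u = x ⊔ (y ⊓ z)`. -/
def JoinSD (L : Type*) [Lattice L] : Prop :=
  ∀ u x y z : L, u = x ⊔ y → u = x ⊔ z → u = x ⊔ (y ⊓ z)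

/-- Meet-semidistributivity: `w = x ⊓ y = x ⊓ z` implies `w = x ⊓ (y ⊔ z)`. -/
def MeetSD (L : Type*) [Lattice L] : Prop :=
  ∀ w x y z : L, w = x ⊓ y → w = x ⊓ z → w = x ⊓ (y ⊔ z)

/-- Semidistributivity. -/
def SD (L : Type*) [Lattice L] : Prop := JoinSD L ∧ MeetSD L

/-- A congruence of a lattice: an equivalence relation compatible with `⊔` and `⊓`. -/
@[ext]
structure LatCon (L : Type*) [Lattice L] where
  r : L → L → Prop
  refl' : ∀ x, r x x
  symm' : ∀ {x y}, r x y → r y x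
  trans' : ∀ {x y z}, r x y → r y z → r x z
  sup' : ∀ {x y x' y'}, r x y → r x' y' → r (x ⊔ x') (y ⊔ y')
  inf' : ∀ {x y x' y'}, r x y → r x' y' → r (x ⊓ x') (y ⊓ y')

namespace LatCon

variable {L : Type*} [Lattice L]

/-- Congruences are ordered by inclusion; this is the order of the congruence
lattice `Con L`. -/
instance instPO : PartialOrder (LatCon L) where
  le c d := ∀ x y, c.r x y → d.r x y
  le_refl _ _ _ h := h
  le_trans _ _ _ h1 h2 x y h := h2 x y (h1 x y h)
  le_antisymm c d h1 h2 := by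
    ext x y
    exact ⟨h1 x y, h2 x y⟩

/-- The congruence lattice `Con L`. -/
instance instLattice : Lattice (LatCon L) where
  sup c d :=
    { r := fun x y => ∀ e : LatCon L, c ≤ e → d ≤ e → e.r x y
      refl' := fun x e _ _ => e.refl' x
      symm' := fun h e hc hd => e.symm' (h e hc hd)
      trans' := fun h1 h2 e hc hd => e.trans' (h1 e hc hd) (h2 e hc hd)
      sup' := fun h1 h2 e hc hd => e.sup' (h1 e hc hd) (h2 e hc hd)
      inf' := fun h1 h2 e hc hd => e.inf' (h1 e hc hd) (h2 e hc hd) }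
  le_sup_left c d := fun x y h e hc _ => hc x y h
  le_sup_right c d := fun x y h e _ hd => hd x y h
  sup_le c d e hc hd := fun x y h => h e hc hd
  inf c d :=
    { r := fun x y => c.r x y ∧ d.r x y
      refl' := fun x => ⟨c.refl' x, d.refl' x⟩
      symm' := fun h => ⟨c.symm' h.1, d.symm' h.2⟩
      trans' := fun h1 h2 => ⟨c.trans' h1.1 h2.1, d.trans' h1.2 h2.2⟩
      sup' := fun h1 h2 => ⟨c.sup' h1.1 h2.1, d.sup' h1.2 h2.2⟩
      inf' := fun h1 h2 => ⟨c.inf' h1.1 h2.1, d.inf' h1.2 h2.2⟩ }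
  inf_le_left c d := fun x y h => h.1
  inf_le_right c d := fun x y h => h.2
  le_inf c d e hc hd := fun x y h => ⟨hc x y h, hd x y h⟩

/-- The equality congruence is the least congruence. -/
instance instOrderBot : OrderBot (LatCon L) where
  bot :=
    { r := Eq
      refl' := fun _ => rfl
      symm' := Eq.symm
      trans' := Eq.trans
      sup' := by rintro x y x' y' rfl rfl; rfl
      inf' := by rintro x y x' y' rfl rfl; rfl }
  bot_le c := by rintro x y rfl; exact c.refl' x

/-- The all congruence is the greatest congruence. -/
instance instOrderTop : OrderTop (LatCon L) where
  top :=
    { r := fun _ _ => True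
      refl' := fun _ => trivial
      symm' := fun _ => trivial
      trans' := fun _ _ => trivial
      sup' := fun _ _ => trivial
      inf' := fun _ _ => trivial }
  le_top _ _ _ _ := trivial

/-- The congruence generated by a pair `(a, b)`. -/
def gen (a b : L) : LatCon L where
  r x y := ∀ c : LatCon L, c.r a b → c.r x y
  refl' x := fun c _ => c.refl' x
  symm' h := fun c hc => c.symm' (h c hc)
  trans' h1 h2 := fun c hc => c.trans' (h1 c hc) (h2 c hc)
  sup' h1 h2 := fun c hc => c.sup' (h1 c hc) (h2 c hc)
  inf' h1 h2 := fun c hc => c.inf' (h1 c hc) (h2 c hc)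

/-- The congruence generated by a set of pairs. -/
def genSet (P : Set (L × L)) : LatCon L where
  r x y := ∀ c : LatCon L, (∀ p ∈ P, c.r p.1 p.2) → c.r x y
  refl' x := fun c _ => c.refl' x
  symm' h := fun c hc => c.symm' (h c hc)
  trans' h1 h2 := fun c hc => c.trans' (h1 c hc) (h2 c hc)
  sup' h1 h2 := fun c hc => c.sup' (h1 c hc) (h2 c hc)
  inf' h1 h2 := fun c hc => c.inf' (h1 c hc) (h2 c hc)

end LatCon

/-- A lattice is simple if its congruence lattice has exactly two elements, namely
the equality relation (`⊥`) and the all relation (`⊤`). -/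
def IsSimpleLat (L : Type*) [Lattice L] : Prop :=
  (∃ x y : L, x ≠ y) ∧ ∀ c : LatCon L, c = (⊥ : LatCon L) ∨ c = (⊤ : LatCon L)

/-- An FN lattice: a simple, infinite, semidistributive lattice. -/
def IsFN (F : Type*) [Lattice F] : Prop := Infinite F ∧ IsSimpleLat F ∧ SD F

/-! ### Helpers for quantifying over lattice structures -/

/-- `SD` for an explicitly given lattice structure. -/
def SDP (K : Type*) (instK : Lattice K) : Prop := by
  letI := instK; exact SD K

/-- `IsFN` for an explicitly given lattice structure. -/
def IsFNP (F : Type*) (instF : Lattice F) : Prop := by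
  letI := instF; exact IsFN F

/-- The congruence lattice of `K` (with explicitly given lattice structure) is
order-isomorphic to `D`. -/
def ConIso (K : Type*) (instK : Lattice K) (D : Type*) [LE D] : Prop := by
  letI := instK; exact Nonempty (LatCon K ≃o D)

/-- `K` (with explicitly given lattice structure) has no greatest and no least element. -/
def UnboundedP (K : Type*) (instK : Lattice K) : Prop := by
  letI := instK; exact (∀ x : K, ¬ IsTop x) ∧ (∀ x : K, ¬ IsBot x)

/-- The order `≤` of an explicitly given lattice structure. -/
def lleOf {α : Type*} (inst : Lattice α) (x y : α) : Prop := by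
  letI := inst; exact x ≤ y

/-- The join of an explicitly given lattice structure. -/
def lsupOf {α : Type*} (inst : Lattice α) (x y : α) : α := by
  letI := inst; exact x ⊔ y

/-- The meet of an explicitly given lattice structure. -/
def linfOf {α : Type*} (inst : Lattice α) (x y : α) : α := by
  letI := inst; exact x ⊓ y

/-! ### The doubling construction -/

/-- The underlying set of the doubling `L[u]`: `(L ∖ {u}) ∪ {u₀, u₁}`, where
`u₀ = Sum.inr false` and `u₁ = Sum.inr true`. -/
def Doubled (L : Type*) (u : L) : Type _ := {x : L // x ≠ u} ⊕ Bool

/-- The element `u₀` of `L[u]`. -/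
def dbl0 {L : Type*} (u : L) : Doubled L u := Sum.inr false

/-- The element `u₁` of `L[u]`. -/
def dbl1 {L : Type*} (u : L) : Doubled L u := Sum.inr true

/-- The order `≤ᵤ` of the doubling `L[u]`. -/
def dle {L : Type*} [Lattice L] (u : L) : Doubled L u → Doubled L u → Prop
  | Sum.inl x, Sum.inl y => (x : L) ≤ y
  | Sum.inl x, Sum.inr _ => (x : L) ≤ u
  | Sum.inr _, Sum.inl y => u ≤ (y : L)
  | Sum.inr i, Sum.inr j => i ≤ j

section
open Classical

/-- The map `L → L[u]` sending `u` to `u₀` and fixing everything else. -/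
noncomputable def iota0 {L : Type*} (u : L) : L → Doubled L u := fun x =>
  if h : x = u then Sum.inr false else Sum.inl ⟨x, h⟩

/-- The map `L → L[u]` sending `u` to `u₁` and fixing everything else. -/
noncomputable def iota1 {L : Type*} (u : L) : L → Doubled L u := fun x =>
  if h : x = u then Sum.inr true else Sum.inl ⟨x, h⟩

end

/-- The projection `L[u] → L` collapsing `u₀` and `u₁` to `u`. -/
def dproj {L : Type*} (u : L) : Doubled L u → L
  | Sum.inl x => (x : L)
  | Sum.inr _ => u

/-! ### Doubling a finite antichain -/

/-- The underlying set of `L[U]`: `(L ∖ U) ∪ ⋃_{u ∈ U} {u₀, u₁}`, where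
`u₀ = Sum.inr (u, false)` and `u₁ = Sum.inr (u, true)`. -/
def DoubledS (L : Type*) (U : Set L) : Type _ := {x : L // x ∉ U} ⊕ (U × Bool)

section
open Classical

/-- The order of `L[U]`. -/
noncomputable def dleS {L : Type*} [Lattice L] (U : Set L) : DoubledS L U → DoubledS L U → Prop
  | Sum.inl x, Sum.inl y => (x : L) ≤ y
  | Sum.inl x, Sum.inr ui => (x : L) ≤ (ui.1 : L)
  | Sum.inr ui, Sum.inl y => (ui.1 : L) ≤ (y : L)
  | Sum.inr ui, Sum.inr vj =>
      if (ui.1 : L) = (vj.1 : L) then ui.2 ≤ vj.2 else (ui.1 : L) ≤ (vj.1 : L)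

end

/-! ### Isolated intervals and the gluing construction -/

/-- An interval `[a, b]` is isolated if `b` covers `a` and both `a` and `b` are
doubly irreducible. -/
def Isolated {L : Type*} [Lattice L] (a b : L) : Prop :=
  a ⋖ b ∧ SupIrred a ∧ InfIrred a ∧ SupIrred b ∧ InfIrred b

/-- The underlying set of `K = L^{a,b} ⊔ F`. -/
def Glued (L F : Type*) (a b : L) : Type _ := {x : L // x ≠ a ∧ x ≠ b} ⊕ F

/-- The order on `K = L^{a,b} ⊔ F`: on each summand the original order; and
`x < f` for `x ∈ L^{a,b}`, `f ∈ F` iff `x ≤ a`, `f < x` iff `b ≤ x`. -/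
def gle {L F : Type*} [Lattice L] [Lattice F] (a b : L) :
    Glued L F a b → Glued L F a b → Prop
  | Sum.inl x, Sum.inl y => (x : L) ≤ y
  | Sum.inl x, Sum.inr _ => (x : L) ≤ a
  | Sum.inr _, Sum.inl y => b ≤ (y : L)
  | Sum.inr f, Sum.inr g => f ≤ g


/-! ### Simple semidistributive lattices have no least and no greatest element -/

section Unbounded

variable {F : Type*} [Lattice F]

/-- The congruence with the two blocks `{x | P x}` and `{x | ¬ P x}`, for a predicate `P`
defining a prime filter. -/
def LatCon.ofPrime (P : F → Prop) (hinf : ∀ x y, P (x ⊓ y) ↔ P x ∧ P y)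
    (hsup : ∀ x y, P (x ⊔ y) ↔ P x ∨ P y) : LatCon F where
  r x y := P x ↔ P y
  refl' _ := Iff.rfl
  symm' h := h.symm
  trans' h₁ h₂ := h₁.trans h₂
  sup' h₁ h₂ := by rw [hsup, hsup, h₁, h₂]
  inf' h₁ h₂ := by rw [hinf, hinf, h₁, h₂]

theorem IsSimpleLat.false_of_prime [Infinite F] (hs : IsSimpleLat F) (P : F → Prop)
    (hinf : ∀ x y, P (x ⊓ y) ↔ P x ∧ P y) (hsup : ∀ x y, P (x ⊔ y) ↔ P x ∨ P y)
    {a b : F} (ha : P a) (hb : ¬ P b) : False := by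
  rcases hs.2 (LatCon.ofPrime P hinf hsup) with h | h
  · have hinj : Function.Injective P := fun x y hxy => by
      have hr : (LatCon.ofPrime P hinf hsup).r x y := iff_of_eq hxy
      rw [h] at hr
      exact hr
    exact not_finite_iff_infinite.2 ‹Infinite F› (Finite.of_injective P hinj)
  · have hr : (LatCon.ofPrime P hinf hsup).r a b := by rw [h]; trivial
    exact hb (hr.1 ha)

/-- A meet-semidistributive lattice with a least element and another element has a prime
filter avoiding the least element: any maximal proper filter. -/
theorem MeetSD.exists_prime (hF : MeetSD F) {o a : F} (ho : IsBot o) (ha : a ≠ o) :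
    ∃ P : F → Prop, (∀ x y, P (x ⊓ y) ↔ P x ∧ P y) ∧ (∀ x y, P (x ⊔ y) ↔ P x ∨ P y) ∧
      P a ∧ ¬ P o := by
  let 𝒮 : Set (Set F) := {M | IsUpperSet M ∧ (∀ x ∈ M, ∀ y ∈ M, x ⊓ y ∈ M) ∧ o ∉ M}
  have hIci : Set.Ici a ∈ 𝒮 :=
    ⟨isUpperSet_Ici a, fun x hx y hy => le_inf hx hy, fun h => ha (le_antisymm h (ho a))⟩
  obtain ⟨M, haM, hM⟩ := zorn_subset_nonempty 𝒮 (by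
    intro c hc hchain hne
    refine ⟨⋃₀ c, ⟨?_, ?_, ?_⟩, fun s hs => Set.subset_sUnion_of_mem hs⟩
    · exact isUpperSet_sUnion fun s hs => (hc hs).1
    · rintro x ⟨s, hs, hx⟩ y ⟨t, ht, hy⟩
      rcases hchain.total hs ht with h | h
      · exact ⟨t, ht, (hc ht).2.1 x (h hx) y hy⟩
      · exact ⟨s, hs, (hc hs).2.1 x hx y (h hy)⟩
    · rintro ⟨s, hs, hos⟩
      exact (hc hs).2.2 hos) _ hIci
  obtain ⟨hup, hmeet, hoM⟩ := hM.prop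
  have key : ∀ y, y ∉ M → ∃ m ∈ M, m ⊓ y = o := by
    intro y hy
    by_contra! hne
    have hN : {z | ∃ m ∈ M, m ⊓ y ≤ z} ∈ 𝒮 := by
      refine ⟨?_, ?_, ?_⟩
      · rintro z w hzw ⟨m, hm, h⟩
        exact ⟨m, hm, h.trans hzw⟩
      · rintro z ⟨m, hm, h⟩ w ⟨m', hm', h'⟩
        exact ⟨m ⊓ m', hmeet m hm m' hm', le_inf
          ((inf_le_inf_right y inf_le_left).trans h) ((inf_le_inf_right y inf_le_right).trans h')⟩
      · rintro ⟨m, hm, h⟩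
        exact hne m hm (le_antisymm h (ho _))
    have hle := hM.le_of_ge hN fun m hm => ⟨m, hm, inf_le_left⟩
    exact hy (hle ⟨a, haM le_rfl, inf_le_right⟩)
  refine ⟨(· ∈ M), fun x y => ⟨fun h => ⟨hup inf_le_left h, hup inf_le_right h⟩,
    fun h => hmeet x h.1 y h.2⟩, fun x y => ⟨fun h => ?_, ?_⟩, haM le_rfl, hoM⟩
  · by_contra! hxy
    obtain ⟨m, hm, hmx⟩ := key x hxy.1
    obtain ⟨k, hk, hky⟩ := key y hxy.2
    have h₁ : o = (m ⊓ k) ⊓ x :=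
      le_antisymm (ho _) (hmx ▸ inf_le_inf_right x inf_le_left)
    have h₂ : o = (m ⊓ k) ⊓ y :=
      le_antisymm (ho _) (hky ▸ inf_le_inf_right y inf_le_right)
    exact hoM (hF o (m ⊓ k) x y h₁ h₂ ▸ hmeet _ (hmeet m hm k hk) _ h)
  · rintro (h | h)
    · exact hup le_sup_left h
    · exact hup le_sup_right h

theorem IsFN.not_isBot (hF : IsFN F) (o : F) : ¬ IsBot o := by
  intro ho
  obtain ⟨_, hs, -, hm⟩ := hF
  obtain ⟨a, ha⟩ := exists_ne o
  obtain ⟨P, hinf, hsup, hPa, hPo⟩ := hm.exists_prime ho ha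
  exact hs.false_of_prime P hinf hsup hPa hPo

theorem IsFN.not_isTop (hF : IsFN F) (i : F) : ¬ IsTop i := by
  intro hi
  obtain ⟨_, hs, hj, -⟩ := hF
  obtain ⟨a, ha⟩ := exists_ne i
  have hdual : MeetSD Fᵒᵈ := hj
  obtain ⟨P, hinf, hsup, hPa, hPi⟩ :=
    hdual.exists_prime (o := OrderDual.toDual i) (a := OrderDual.toDual a) hi ha
  refine hs.false_of_prime (fun x => ¬ P (OrderDual.toDual x)) (fun x y => ?_) (fun x y => ?_)
    hPi (not_not.2 hPa)
  · rw [toDual_inf, hsup, not_or]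
  · rw [toDual_sup, hinf, not_and_or]

end Unbounded

/-! ### Doubling the elements of a set -/

/-- The lattice obtained from `F` by doubling every element of `U`. The two copies of `u ∈ U`
are distinguished by the proposition `up`, which is false for all other elements. -/
@[ext]
structure SetDoubling {F : Type*} (U : Set F) where
  val : F
  up : Prop
  mem : up → val ∈ U

namespace SetDoubling

variable {F : Type*} {U : Set F}

/-- The lower (or only) copy of an element. -/
def low (U : Set F) (x : F) : SetDoubling U := ⟨x, False, False.elim⟩

/-- The upper copy of a doubled element. -/
def high {u : F} (hu : u ∈ U) : SetDoubling U := ⟨u, True, fun _ => hu⟩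

@[simp] theorem val_low (x : F) : (low U x).val = x := rfl
@[simp] theorem up_low (x : F) : (low U x).up = False := rfl
@[simp] theorem val_high {u : F} (hu : u ∈ U) : (high hu).val = u := rfl
@[simp] theorem up_high {u : F} (hu : u ∈ U) : (high hu).up = True := rfl

theorem eq_low_or_eq_high (X : SetDoubling U) :
    X = low U X.val ∨ ∃ h : X.val ∈ U, X = high h := by
  by_cases h : X.up
  · exact .inr ⟨X.mem h, SetDoubling.ext rfl (eq_true h)⟩
  · exact .inl (SetDoubling.ext rfl (eq_false h))

theorem infinite [Infinite F] : Infinite (SetDoubling U) :=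
  Infinite.of_injective (low U) fun _ _ h => congrArg SetDoubling.val h

variable [Lattice F]

instance : PartialOrder (SetDoubling U) where
  le X Y := X.val ≤ Y.val ∧ (X.val = Y.val → X.up → Y.up)
  le_refl _ := ⟨le_rfl, fun _ h => h⟩
  le_trans X Y Z h₁ h₂ := ⟨h₁.1.trans h₂.1, fun h hX => by
    have h' : X.val = Y.val := le_antisymm h₁.1 (h ▸ h₂.1)
    exact h₂.2 (h' ▸ h) (h₁.2 h' hX)⟩
  le_antisymm X Y h₁ h₂ := by
    have h := le_antisymm h₁.1 h₂.1
    exact SetDoubling.ext h (propext ⟨h₁.2 h, h₂.2 h.symm⟩)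

theorem le_def {X Y : SetDoubling U} :
    X ≤ Y ↔ X.val ≤ Y.val ∧ (X.val = Y.val → X.up → Y.up) := Iff.rfl

instance : Lattice (SetDoubling U) where
  sup X Y :=
    { val := X.val ⊔ Y.val
      up := (Y.val ≤ X.val ∧ X.up) ∨ (X.val ≤ Y.val ∧ Y.up)
      mem := by
        rintro (⟨h, hX⟩ | ⟨h, hY⟩)
        · rw [sup_eq_left.2 h]; exact X.mem hX
        · rw [sup_eq_right.2 h]; exact Y.mem hY }
  le_sup_left X Y := ⟨le_sup_left, fun h hX => .inl ⟨left_eq_sup.1 h, hX⟩⟩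
  le_sup_right X Y := ⟨le_sup_right, fun h hY => .inr ⟨right_eq_sup.1 h, hY⟩⟩
  sup_le X Y Z h₁ h₂ := ⟨sup_le h₁.1 h₂.1, by
    rintro h (⟨hle, hX⟩ | ⟨hle, hY⟩)
    · exact h₁.2 ((sup_eq_left.2 hle).symm.trans h) hX
    · exact h₂.2 ((sup_eq_right.2 hle).symm.trans h) hY⟩
  inf X Y :=
    { val := X.val ⊓ Y.val
      up := X.val ⊓ Y.val ∈ U ∧ (X.val ≤ Y.val → X.up) ∧ (Y.val ≤ X.val → Y.up)
      mem := And.left }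
  inf_le_left X Y := ⟨inf_le_left, fun h hup => hup.2.1 (inf_eq_left.1 h)⟩
  inf_le_right X Y := ⟨inf_le_right, fun h hup => hup.2.2 (inf_eq_right.1 h)⟩
  le_inf X Y Z h₁ h₂ := ⟨le_inf h₁.1 h₂.1, fun h hX => ⟨by
    have hU := X.mem hX
    rwa [h] at hU,
    fun hle => h₁.2 (h.trans (inf_eq_left.2 hle)) hX,
    fun hle => h₂.2 (h.trans (inf_eq_right.2 hle)) hX⟩⟩

@[simp] theorem val_sup (X Y : SetDoubling U) : (X ⊔ Y).val = X.val ⊔ Y.val := rfl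
@[simp] theorem val_inf (X Y : SetDoubling U) : (X ⊓ Y).val = X.val ⊓ Y.val := rfl

@[simp] theorem up_sup (X Y : SetDoubling U) :
    (X ⊔ Y).up = ((Y.val ≤ X.val ∧ X.up) ∨ (X.val ≤ Y.val ∧ Y.up)) := rfl

@[simp] theorem up_inf (X Y : SetDoubling U) : (X ⊓ Y).up =
    (X.val ⊓ Y.val ∈ U ∧ (X.val ≤ Y.val → X.up) ∧ (Y.val ≤ X.val → Y.up)) := rfl

theorem joinSD (hF : JoinSD F) : JoinSD (SetDoubling U) := by
  rintro W X Y Z rfl h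
  obtain ⟨x, b, hb⟩ := X
  obtain ⟨y, c, hc⟩ := Y
  obtain ⟨z, d, hd⟩ := Z
  rw [SetDoubling.ext_iff] at h
  simp only [val_sup, up_sup] at h
  obtain ⟨h₁, h₂⟩ := h
  have h₃ := hF _ x y z rfl h₁
  refine SetDoubling.ext h₃ (propext ?_)
  have hle : y ⊓ z ≤ x ↔ y ≤ x := by
    rw [← sup_eq_left, ← h₃, sup_eq_left]
  have hle' : z ≤ x ↔ y ≤ x := by
    rw [← sup_eq_left, ← h₁, sup_eq_left]
  have heq : x ≤ y → x ≤ z → y = z := fun hy hz => by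
    rwa [sup_eq_right.2 hy, sup_eq_right.2 hz] at h₁
  simp only [val_inf, up_sup, up_inf, hle, hle', le_inf_iff] at h₂ ⊢
  grind

theorem meetSD (hF : MeetSD F) : MeetSD (SetDoubling U) := by
  rintro W X Y Z rfl h
  obtain ⟨x, b, hb⟩ := X
  obtain ⟨y, c, hc⟩ := Y
  obtain ⟨z, d, hd⟩ := Z
  rw [SetDoubling.ext_iff] at h
  simp only [val_inf, up_inf] at h
  obtain ⟨h₁, h₂⟩ := h
  have h₃ := hF _ x y z rfl h₁
  refine SetDoubling.ext h₃ (propext ?_)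
  have hle : x ≤ y ⊔ z ↔ x ≤ y := by
    rw [← inf_eq_left, ← h₃, inf_eq_left]
  have hle' : x ≤ z ↔ x ≤ y := by
    rw [← inf_eq_left, ← h₁, inf_eq_left]
  have heq : y ≤ x → z ≤ x → y = z := fun hy hz => by
    rwa [inf_eq_right.2 hy, inf_eq_right.2 hz] at h₁
  simp only [val_sup, up_sup, up_inf, hle, hle', sup_le_iff] at h₂ ⊢
  grind

theorem sd (hF : SD F) : SD (SetDoubling U) := ⟨joinSD hF.1, meetSD hF.2⟩

/-- The congruence collapsing the two copies of each element of `V`. -/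
def collapse (U V : Set F) : LatCon (SetDoubling U) where
  r X Y := X.val = Y.val ∧ (X.val ∉ V → (X.up ↔ Y.up))
  refl' _ := ⟨rfl, fun _ => Iff.rfl⟩
  symm' h := ⟨h.1.symm, fun hV => (h.2 (h.1 ▸ hV)).symm⟩
  trans' h₁ h₂ := ⟨h₁.1.trans h₂.1, fun hV => (h₁.2 hV).trans (h₂.2 (h₁.1 ▸ hV))⟩
  sup' {X Y X' Y'} h₁ h₂ := by
    obtain ⟨x, b, hb⟩ := X
    obtain ⟨y, c, hc⟩ := Y
    obtain ⟨x', b', hb'⟩ := X'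
    obtain ⟨y', c', hc'⟩ := Y'
    obtain ⟨rfl : x = y, h₁⟩ := h₁
    obtain ⟨rfl : x' = y', h₂⟩ := h₂
    refine ⟨rfl, fun hV => ?_⟩
    simp only [val_sup, up_sup] at hV h₁ h₂ ⊢
    refine or_congr (and_congr_right fun h => h₁ ?_) (and_congr_right fun h => h₂ ?_)
    · rwa [sup_eq_left.2 h] at hV
    · rwa [sup_eq_right.2 h] at hV
  inf' {X Y X' Y'} h₁ h₂ := by
    obtain ⟨x, b, hb⟩ := X
    obtain ⟨y, c, hc⟩ := Y
    obtain ⟨x', b', hb'⟩ := X'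
    obtain ⟨y', c', hc'⟩ := Y'
    obtain ⟨rfl : x = y, h₁⟩ := h₁
    obtain ⟨rfl : x' = y', h₂⟩ := h₂
    refine ⟨rfl, fun hV => ?_⟩
    simp only [val_inf, up_inf] at hV h₁ h₂ ⊢
    refine and_congr_right fun _ => and_congr (forall_congr' fun h => h₁ ?_)
      (forall_congr' fun h => h₂ ?_)
    · rwa [inf_eq_left.2 h] at hV
    · rwa [inf_eq_right.2 h] at hV

theorem collapse_low_high {V : Set F} {u : F} (hu : u ∈ U) :
    (collapse U V).r (low U u) (high hu) ↔ u ∈ V := by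
  simp [collapse]

theorem collapse_le_collapse {V W : Set F} (hV : V ⊆ U) :
    collapse U V ≤ collapse U W ↔ V ⊆ W := by
  refine ⟨fun h u hu => ?_, fun h X Y hXY => ⟨hXY.1, fun hW => hXY.2 fun hV => hW (h hV)⟩⟩
  exact (collapse_low_high (hV hu)).1 (h _ _ ((collapse_low_high (hV hu)).2 hu))

theorem not_top_le_collapse [Nontrivial F] (V : Set F) : ¬ ⊤ ≤ collapse U V := by
  intro h
  obtain ⟨x, y, hxy⟩ := exists_pair_ne F
  exact hxy (h (low U x) (low U y) trivial).1

/-- A congruence identifying only copies of the same element is of the form `collapse U V`. -/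
theorem eq_collapse (θ : LatCon (SetDoubling U)) (h : ∀ X Y, θ.r X Y → X.val = Y.val) :
    θ = collapse U {u | ∃ hu : u ∈ U, θ.r (low U u) (high hu)} := by
  refine le_antisymm ?_ ?_
  · rintro ⟨x, b, hb⟩ ⟨y, c, hc⟩ hXY
    obtain rfl : x = y := h _ _ hXY
    refine ⟨rfl, fun hV => ⟨fun hbt => ?_, fun hct => ?_⟩⟩ <;> by_contra hf <;> refine hV ?_
    · have h₁ : (⟨x, b, hb⟩ : SetDoubling U) = high (hb hbt) := SetDoubling.ext rfl (eq_true hbt)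
      have h₂ : (⟨x, c, hc⟩ : SetDoubling U) = low U x := SetDoubling.ext rfl (eq_false hf)
      rw [h₁, h₂] at hXY
      exact ⟨hb hbt, θ.symm' hXY⟩
    · have h₁ : (⟨x, b, hb⟩ : SetDoubling U) = low U x := SetDoubling.ext rfl (eq_false hf)
      have h₂ : (⟨x, c, hc⟩ : SetDoubling U) = high (hc hct) := SetDoubling.ext rfl (eq_true hct)
      rw [h₁, h₂] at hXY
      exact ⟨hc hct, hXY⟩
  · rintro ⟨x, b, hb⟩ ⟨y, c, hc⟩ ⟨rfl : x = y, hV⟩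
    by_cases hx : ∃ hu : x ∈ U, θ.r (low U x) (high hu)
    · obtain ⟨hu, hx⟩ := hx
      have hlow : ∀ Z : SetDoubling U, Z.val = x → θ.r (low U x) Z := by
        rintro Z rfl
        rcases eq_low_or_eq_high Z with hZ | ⟨_, hZ⟩
        · rw [← hZ]
          exact θ.refl' Z
        · rwa [← hZ] at hx
      exact θ.trans' (θ.symm' (hlow _ rfl)) (hlow _ rfl)
    · obtain rfl : b = c := propext (hV hx)
      exact θ.refl' _

/-- The congruence of `F` generated by the image of a congruence of the doubling. -/
def push (θ : LatCon (SetDoubling U)) : LatCon F where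
  r := Relation.ReflTransGen fun x y => ∃ X Y, θ.r X Y ∧ X.val = x ∧ Y.val = y
  refl' _ := .refl
  symm' h := by
    induction h with
    | refl => exact .refl
    | tail _ h ih =>
      obtain ⟨X, Y, h, hX, hY⟩ := h
      exact .head ⟨Y, X, θ.symm' h, hY, hX⟩ ih
  trans' := .trans
  sup' {x y x' y'} h₁ h₂ := by
    have h₃ := h₁.lift (· ⊔ x') (p := fun x y => ∃ X Y, θ.r X Y ∧ X.val = x ∧ Y.val = y) (by
      rintro _ _ ⟨X, Y, h, rfl, rfl⟩
      exact ⟨_, _, θ.sup' h (θ.refl' (low U x')), rfl, rfl⟩)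
    have h₄ := h₂.lift (y ⊔ ·) (p := fun x y => ∃ X Y, θ.r X Y ∧ X.val = x ∧ Y.val = y) (by
      rintro _ _ ⟨X, Y, h, rfl, rfl⟩
      exact ⟨_, _, θ.sup' (θ.refl' (low U y)) h, rfl, rfl⟩)
    exact h₃.trans h₄
  inf' {x y x' y'} h₁ h₂ := by
    have h₃ := h₁.lift (· ⊓ x') (p := fun x y => ∃ X Y, θ.r X Y ∧ X.val = x ∧ Y.val = y) (by
      rintro _ _ ⟨X, Y, h, rfl, rfl⟩
      exact ⟨_, _, θ.inf' h (θ.refl' (low U x')), rfl, rfl⟩)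
    have h₄ := h₂.lift (y ⊓ ·) (p := fun x y => ∃ X Y, θ.r X Y ∧ X.val = x ∧ Y.val = y) (by
      rintro _ _ ⟨X, Y, h, rfl, rfl⟩
      exact ⟨_, _, θ.inf' (θ.refl' (low U y)) h, rfl, rfl⟩)
    exact h₃.trans h₄

/-- A map whose values are compatible with `θ` is compatible with `push θ`. -/
theorem rel_of_push {θ : LatCon (SetDoubling U)} {f : F → SetDoubling U}
    (hf : ∀ X Y, θ.r X Y → θ.r (f X.val) (f Y.val)) {x y : F} (h : (push θ).r x y) :
    θ.r (f x) (f y) := by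
  induction h with
  | refl => exact θ.refl' _
  | tail _ h ih =>
    obtain ⟨X, Y, h, rfl, rfl⟩ := h
    exact θ.trans' ih (hf X Y h)

theorem sup_high (hU : IsAntichain (· ≤ ·) U) {u : F} (hu : u ∈ U) (X : SetDoubling U) :
    X ⊔ high hu = low U X.val ⊔ high hu := by
  refine SetDoubling.ext rfl (propext ?_)
  simp only [up_sup, val_high, up_high, val_low, up_low, and_false, and_true, false_or,
    or_iff_right_iff_imp]
  exact fun h => (hU.eq hu (X.mem h.2) h.1).ge

theorem inf_low (hU : IsAntichain (· ≤ ·) U) {u : F} (hu : u ∈ U) (X : SetDoubling U) :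
    X ⊓ low U u = low U X.val ⊓ low U u := by
  refine SetDoubling.ext rfl (propext ?_)
  have heq : X.up → X.val ≤ u → u ≤ X.val := fun h hle => (hU.eq (X.mem h) hu hle).ge
  simp only [up_inf, val_low, up_low]
  grind

theorem low_rel_high (hU : IsAntichain (· ≤ ·) U) {θ : LatCon (SetDoubling U)}
    (hθ : push θ = ⊤) {u b : F} (hu : u ∈ U) (hub : ¬ u ≤ b) (hbu : ¬ b ≤ u) :
    θ.r (low U u) (high hu) := by
  have hpush : ∀ x y, (push θ).r x y := fun x y => hθ ▸ trivial
  have h₁ : θ.r (low U b ⊔ high hu) (low U u ⊔ high hu) :=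
    rel_of_push (f := fun x => low U x ⊔ high hu) (fun X Y h => by
      rw [← sup_high hU, ← sup_high hU]
      exact θ.sup' h (θ.refl' _)) (hpush b u)
  have h₂ : θ.r (low U b ⊓ low U u) (low U u ⊓ low U u) :=
    rel_of_push (f := fun x => low U x ⊓ low U u) (fun X Y h => by
      rw [← inf_low hU hu, ← inf_low hU hu]
      exact θ.inf' h (θ.refl' _)) (hpush b u)
  have e₁ : low U u ⊔ high hu = high hu := by ext <;> simp
  have e₂ : low U b ⊔ high hu = low U b ⊔ low U u := by ext <;> simp [hub, hbu]
  have e₃ : low U b ⊓ high hu = low U b ⊓ low U u := by ext <;> simp [hub, hbu]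
  rw [e₁, e₂] at h₁
  rw [inf_idem] at h₂
  have h₃ : θ.r (low U b) (low U b ⊓ low U u) := by
    simpa [e₃, inf_sup_self] using θ.inf' (θ.refl' (low U b)) h₁
  have h₄ : θ.r (low U b ⊔ low U u) (low U u) := by
    simpa using θ.sup' (θ.trans' h₃ h₂) (θ.refl' (low U u))
  exact θ.trans' (θ.symm' h₄) h₁

/-- In the doubling of an antichain of a simple lattice, each of whose members is incomparable
to some element, every congruence identifying copies of distinct elements is the all relation. -/
theorem eq_top (hF : IsSimpleLat F) (hU : IsAntichain (· ≤ ·) U)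
    (hinc : ∀ u ∈ U, ∃ b, ¬ u ≤ b ∧ ¬ b ≤ u) {θ : LatCon (SetDoubling U)}
    {X Y : SetDoubling U} (hXY : θ.r X Y) (hne : X.val ≠ Y.val) : θ = ⊤ := by
  have hθ : push θ = ⊤ := (hF.2 (push θ)).resolve_left fun h => hne <| by
    have hr : (push θ).r X.val Y.val := .single ⟨X, Y, hXY, rfl, rfl⟩
    rw [h] at hr
    exact hr
  have hlow : ∀ Z : SetDoubling U, θ.r (low U Z.val) Z := by
    intro Z
    rcases eq_low_or_eq_high Z with h | ⟨hu, h⟩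
    · rw [← h]
      exact θ.refl' Z
    · obtain ⟨b, hub, hbu⟩ := hinc _ hu
      have := low_rel_high hU hθ hu hub hbu
      rwa [← h] at this
  refine le_antisymm le_top fun Z W _ => θ.trans' (θ.symm' (hlow Z)) (θ.trans' ?_ (hlow W))
  exact rel_of_push (fun X Y h => θ.trans' (hlow X) (θ.trans' h (θ.symm' (hlow Y))))
    (hθ ▸ trivial : (push θ).r Z.val W.val)

/-- The congruence lattice of the doubling of `U`. -/
theorem nonempty_orderIso [Nontrivial F] (hF : IsSimpleLat F) (hU : IsAntichain (· ≤ ·) U)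
    (hinc : ∀ u ∈ U, ∃ b, ¬ u ≤ b ∧ ¬ b ≤ u) :
    Nonempty (LatCon (SetDoubling U) ≃o WithTop (Set U)) := by
  let f : WithTop (Set U) → LatCon (SetDoubling U) :=
    WithTop.recTopCoe ⊤ fun V => collapse U (Subtype.val '' V)
  have hf : ∀ V W, f V ≤ f W ↔ V ≤ W := by
    intro V W
    induction W with
    | top => exact iff_of_true le_top le_top
    | coe W =>
      induction V with
      | top => exact iff_of_false (not_top_le_collapse _) (WithTop.not_top_le_coe W)
      | coe V =>
        rw [WithTop.coe_le_coe]
        exact (collapse_le_collapse (Subtype.coe_image_subset U V)).trans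
          (Set.image_subset_image_iff Subtype.val_injective)
  refine ⟨(RelIso.ofSurjective (OrderEmbedding.ofMapLEIff f hf) fun θ => ?_).symm⟩
  by_cases h : ∀ X Y, θ.r X Y → X.val = Y.val
  · refine ⟨((Subtype.val ⁻¹' {u | ∃ hu : u ∈ U, θ.r (low U u) (high hu)} : Set U) :
      WithTop (Set U)), ?_⟩
    have hsub : {u | ∃ hu : u ∈ U, θ.r (low U u) (high hu)} ⊆ U := fun u hu => hu.1
    refine Eq.trans ?_ (eq_collapse θ h).symm
    change collapse U (Subtype.val '' _) = _
    rw [Subtype.image_preimage_coe, Set.inter_eq_right.2 hsub]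
  · push Not at h
    obtain ⟨X, Y, hXY, hne⟩ := h
    exact ⟨⊤, (eq_top hF hU hinc hXY hne).symm⟩

theorem not_isTop (hF : ∀ x : F, ¬ IsTop x) (X : SetDoubling U) : ¬ IsTop X :=
  fun h => hF X.val fun y => (h (low U y)).1

theorem not_isBot (hF : ∀ x : F, ¬ IsBot x) (X : SetDoubling U) : ¬ IsBot X :=
  fun h => hF X.val fun y => (h (low U y)).1

end SetDoubling

/-! ### STATEMENT 10 -/

/-- For every `n ≥ 0` there is an infinite semidistributive lattice `Lₙ` with
`Con Lₙ ≅ Bₙ⁺` (assuming the existence of an FN lattice containing antichains of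
every finite size); moreover for `n ≥ 1` the lattice `Lₙ` can be taken to have no
least and no greatest element. -/
theorem statement10
    (hFN : ∃ (F : Type) (instF : Lattice F), IsFNP F instF ∧
      (∀ m : ℕ, ∃ S : Finset F,
        S.card = m ∧ IsAntichain (fun x y => lleOf instF x y) (↑S : Set F))) :
    ∀ n : ℕ, ∃ (K : Type) (instK : Lattice K),
      Infinite K ∧ SDP K instK ∧ ConIso K instK (WithTop (Set (Fin n))) ∧
      (1 ≤ n → UnboundedP K instK) := by
  obtain ⟨F, instF, hF, hanti⟩ := hFN
  have hF' : IsFN F := hF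
  intro n
  obtain ⟨S, hcard, hS⟩ := hanti (n + 1)
  obtain ⟨b, hb⟩ : S.Nonempty := Finset.card_pos.1 (by omega)
  classical
  have hSle : IsAntichain (· ≤ ·) (S : Set F) := hS
  have hsub : (↑(S.erase b) : Set F) ⊆ S := Finset.coe_subset.2 (S.erase_subset b)
  have : Infinite F := hF'.1
  have e : (↑(S.erase b) : Set F) ≃ Fin n :=
    (S.erase b).equivFinOfCardEq (by rw [Finset.card_erase_of_mem hb, hcard]; rfl)
  obtain ⟨iso⟩ := SetDoubling.nonempty_orderIso hF'.2.1 (hSle.subset hsub) fun u hu =>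
    have hne : u ≠ b := Finset.ne_of_mem_erase hu
    ⟨b, hSle (hsub hu) hb hne, hSle hb (hsub hu) hne.symm⟩
  exact ⟨SetDoubling (↑(S.erase b) : Set F), inferInstance, SetDoubling.infinite,
    SetDoubling.sd hF'.2.2, ⟨iso.trans e.toOrderIsoSet.withTopCongr⟩, fun _ =>
    ⟨SetDoubling.not_isTop hF'.not_isTop, SetDoubling.not_isBot hF'.not_isBot⟩⟩
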